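/- arXiv:1307.0070 — 2 statements merged into one kernel-verified Lean document; each statement's English description precedes it below -/
import Mathlib

section
/- Let G be a group and m, l ∈ G with l in the commutator subgroup [G,G], and suppose there exists a group homomorphism ρ₀ : G → SU(2) with image contained in {I, −I}, ρ₀(m) = −I and ρ₀(l) = I. Let p and q be coprime integers and suppose that every group homomorphism ρ : G → SU(2) satisfying ρ(m)^p ρ(l)^q = I has cyclic image. Then every point (θ,η) ∈ R(G,m,l) with (pθ + qη) ∈ 2πℤ or (pθ + pπ + qη) ∈ 2πℤ satisfies η ∈ 2πℤ. (Equivalently, R(G,m,l) ∩ S(p/q) ⊆ {η ∈ 2πℤ}.) -/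
open Real

/-- `SU(2)`: the group of 2×2 complex special unitary matrices, as a subgroup of the
unitary group. -/
noncomputable def SU2 : Subgroup (Matrix.unitaryGroup (Fin 2) ℂ) where
  carrier := {A | (A : Matrix (Fin 2) (Fin 2) ℂ).det = 1}
  one_mem' := by simp
  mul_mem' := by
    intro a b ha hb
    simp only [Set.mem_setOf_eq] at *
    simp only [Matrix.UnitaryGroup.mul_apply] at *
    rw [Matrix.det_mul, ha, hb, mul_one]
  inv_mem' := by
    intro a ha
    simp only [Set.mem_setOf_eq] at *
    have h : ((a⁻¹ : Matrix.unitaryGroup (Fin 2) ℂ) : Matrix (Fin 2) (Fin 2) ℂ)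
        = star (a : Matrix (Fin 2) (Fin 2) ℂ) := rfl
    rw [h]
    simp [Matrix.star_eq_conjTranspose, Matrix.det_conjTranspose, ha]

/-- The underlying matrix of an element of `SU(2)`. -/
noncomputable def SU2.mat (A : SU2) : Matrix (Fin 2) (Fin 2) ℂ :=
  ((A : Matrix.unitaryGroup (Fin 2) ℂ) : Matrix (Fin 2) (Fin 2) ℂ)

/-- The diagonal matrix `diag(e^{iθ}, e^{-iθ})`. -/
noncomputable def Dmat (θ : ℝ) : Matrix (Fin 2) (Fin 2) ℂ :=
  Matrix.diagonal ![Complex.exp (θ * Complex.I), Complex.exp (-θ * Complex.I)]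

theorem Dmat_mem_unitary (θ : ℝ) : Dmat θ ∈ Matrix.unitaryGroup (Fin 2) ℂ := by
  constructor <;>
  · ext i j
    fin_cases i <;> fin_cases j <;>
      simp [Dmat, Matrix.mul_apply, Fin.sum_univ_two, Matrix.diagonal,
        Matrix.conjTranspose_apply, ← Complex.exp_conj, ← Complex.exp_add, Complex.exp_zero,
        mul_comm]

theorem Dmat_det (θ : ℝ) : (Dmat θ).det = 1 := by
  simp [Dmat, Matrix.det_diagonal, Fin.prod_univ_two, ← Complex.exp_add]

/-- `D(θ) = diag(e^{iθ}, e^{-iθ})` as an element of `SU(2)`. -/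
noncomputable def DSU (θ : ℝ) : SU2 := ⟨⟨Dmat θ, Dmat_mem_unitary θ⟩, Dmat_det θ⟩

/-- The pillowcase set `R(G,m,l)`: pairs `(θ, η)` such that some homomorphism
`ρ : G → SU(2)` satisfies `ρ(m) = D(θ)` and `ρ(l) = D(η)`. -/
def RSet (G : Type*) [Group G] (m l : G) : Set (ℝ × ℝ) :=
  {x | ∃ ρ : G →* SU2, ρ m = DSU x.1 ∧ ρ l = DSU x.2}

theorem SU2.mat_injective : Function.Injective SU2.mat :=
  fun _ _ h => Subtype.ext (Subtype.ext h)

@[simp] theorem SU2.mat_one : SU2.mat 1 = 1 := rfl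

@[simp] theorem SU2.mat_mul (A B : SU2) : SU2.mat (A * B) = SU2.mat A * SU2.mat B := rfl

@[simp] theorem mat_DSU (θ : ℝ) : SU2.mat (DSU θ) = Dmat θ := rfl

theorem DSU_add (a b : ℝ) : DSU (a + b) = DSU a * DSU b := by
  apply SU2.mat_injective
  simp only [SU2.mat_mul, mat_DSU, Dmat, Matrix.diagonal_mul_diagonal]
  congr 1
  ext i
  fin_cases i <;> simp [← Complex.exp_add] <;> ring_nf

/-- The one-parameter subgroup `θ ↦ D(θ)` of `SU(2)`. -/
noncomputable def DSUHom : Multiplicative ℝ →* SU2 :=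
  MonoidHom.mk' (fun x => DSU x.toAdd) fun x y => DSU_add x.toAdd y.toAdd

theorem DSU_int_mul (n : ℤ) (a : ℝ) : DSU (n * a) = DSU a ^ n := by
  simpa [DSUHom] using map_zpow DSUHom (Multiplicative.ofAdd a) n

theorem DSU_eq_one_iff {a : ℝ} : DSU a = 1 ↔ ∃ k : ℤ, a = 2 * π * k := by
  have h_exp : Complex.exp (a * Complex.I) = 1 ↔ ∃ k : ℤ, a = 2 * π * k := by
    rw [Complex.exp_eq_one_iff]
    refine exists_congr fun k => ?_
    rw [← mul_assoc, mul_left_inj' Complex.I_ne_zero, mul_comm (k : ℂ)]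
    exact_mod_cast Iff.rfl
  rw [← h_exp, ← SU2.mat_injective.eq_iff, mat_DSU, SU2.mat_one, Dmat,
    Matrix.diagonal_eq_one]
  refine ⟨fun h => congrFun h 0, fun h => ?_⟩
  ext i
  fin_cases i <;> simp [h, Complex.exp_neg]

theorem mat_DSU_pi : SU2.mat (DSU π) = -1 := by
  ext i j
  fin_cases i <;> fin_cases j <;> simp [Dmat, Complex.exp_neg]

theorem SU2.commute_of_mat_eq {A : SU2} (h : SU2.mat A = 1 ∨ SU2.mat A = -1) (B : SU2) :
    Commute A B := by
  apply SU2.mat_injective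
  rcases h with h | h <;> simp [h]

theorem map_eq_one_of_mem_commutator {G H : Type*} [Group G] [Group H] (ρ : G →* H)
    [IsCyclic ρ.range] {l : G} (hl : l ∈ commutator G) : ρ l = 1 := by
  let _ : CommGroup ρ.range := IsCyclic.commGroup
  have h := Abelianization.commutator_subset_ker ρ.rangeRestrict hl
  exact congrArg Subtype.val (MonoidHom.mem_ker.mp h)

theorem exists_eq_two_pi_mul_of_cyclic {G : Type*} [Group G] {m l : G}
    (hl : l ∈ commutator G) {p q : ℤ}
    (hcyc : ∀ ρ : G →* SU2, ρ m ^ p * ρ l ^ q = 1 → IsCyclic ρ.range) {θ η : ℝ}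
    (hmem : (θ, η) ∈ RSet G m l) (hline : ∃ k : ℤ, (p : ℝ) * θ + (q : ℝ) * η = 2 * π * k) :
    ∃ k : ℤ, η = 2 * π * (k : ℝ) := by
  obtain ⟨ρ, hm, hη⟩ := hmem
  have := hcyc ρ (by
    rw [hm, hη, ← DSU_int_mul, ← DSU_int_mul, ← DSU_add]
    exact DSU_eq_one_iff.mpr hline)
  rw [← DSU_eq_one_iff, ← hη]
  exact map_eq_one_of_mem_commutator ρ hl

theorem add_pi_mem_RSet {G : Type*} [Group G] {m l : G} (ρ₀ : G →* SU2)
    (hcentral : ∀ g : G, SU2.mat (ρ₀ g) = 1 ∨ SU2.mat (ρ₀ g) = -1)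
    (hρm : SU2.mat (ρ₀ m) = -1) (hρl : SU2.mat (ρ₀ l) = 1) {θ η : ℝ}
    (hmem : (θ, η) ∈ RSet G m l) : (θ + π, η) ∈ RSet G m l := by
  obtain ⟨ρ, hm, hη⟩ := hmem
  have hm₀ : ρ₀ m = DSU π := SU2.mat_injective (hρm.trans mat_DSU_pi.symm)
  have hl₀ : ρ₀ l = 1 := SU2.mat_injective hρl
  refine ⟨MonoidHom.mk' (fun g => ρ g * ρ₀ g) fun a b => ?_, ?_, ?_⟩
  · rw [map_mul, map_mul]
    exact ((SU2.commute_of_mat_eq (hcentral a) (ρ b)).symm.mul_mul_mul_comm _ _)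
  · simp [hm, hm₀, DSU_add]
  · simp [hη, hl₀]

/-- Suppose `l` lies in the commutator subgroup, there is a central homomorphism
`ρ₀ : G → SU(2)` with image in `{I,-I}`, `ρ₀(m) = -I`, `ρ₀(l) = I`, and `p, q` are coprime
integers such that every `ρ : G → SU(2)` with `ρ(m)^p ρ(l)^q = I` has cyclic image
(the surgery is `SU(2)`-cyclic).  Then every `(θ,η) ∈ R(G,m,l)` with `pθ+qη ∈ 2πℤ` or
`pθ+pπ+qη ∈ 2πℤ` satisfies `η ∈ 2πℤ`. -/
theorem statement_4 {G : Type*} [Group G] (m l : G) (hl : l ∈ commutator G)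
    (ρ₀ : G →* SU2)
    (hcentral : ∀ g : G, SU2.mat (ρ₀ g) = 1 ∨ SU2.mat (ρ₀ g) = -1)
    (hρm : SU2.mat (ρ₀ m) = -1) (hρl : SU2.mat (ρ₀ l) = 1)
    (p q : ℤ) (hpq : IsCoprime p q)
    (hcyc : ∀ ρ : G →* SU2, ρ m ^ p * ρ l ^ q = 1 → IsCyclic ρ.range) :
    ∀ θ η : ℝ, (θ, η) ∈ RSet G m l →
      ((∃ k : ℤ, (p : ℝ) * θ + (q : ℝ) * η = 2 * π * k) ∨
       (∃ k : ℤ, (p : ℝ) * θ + (p : ℝ) * π + (q : ℝ) * η = 2 * π * k)) →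
      ∃ k : ℤ, η = 2 * π * (k : ℝ) := by
  rintro θ η hmem (hline | ⟨k, hk⟩)
  · exact exists_eq_two_pi_mul_of_cyclic hl hcyc hmem hline
  · refine exists_eq_two_pi_mul_of_cyclic hl hcyc
      (add_pi_mem_RSet ρ₀ hcentral hρm hρl hmem) ⟨k, ?_⟩
    rw [mul_add, hk]
end

section
/- Let r₁ = p₁/q₁ and r₂ = p₂/q₂ be distinct rational numbers in lowest terms with p₁ and p₂ nonzero, and let (θ,η) ∈ S(r₁) ∩ S(r₂) ∩ W*. For i = 1, 2: if η > d_i(r₁,r₂), then there exists a point (θ',η') ∈ S(r₁) ∩ S(r₂) ∩ W* adjacent to (θ,η) in S(r_i) with η' < η; and if η < 2π − d_i(r₁,r₂), then there exists a point (θ',η') ∈ S(r₁) ∩ S(r₂) ∩ W* adjacent to (θ,η) in S(r_i) with η' > η. -/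
open Real

/-- The set `S(p/q) = {(θ,η) : pθ+qη ∈ 2πℤ or pθ+pπ+qη ∈ 2πℤ}`. -/
def Spq (p q : ℤ) : Set (ℝ × ℝ) :=
  {x | (∃ k : ℤ, (p : ℝ) * x.1 + (q : ℝ) * x.2 = 2 * π * k) ∨
       (∃ k : ℤ, (p : ℝ) * x.1 + (p : ℝ) * π + (q : ℝ) * x.2 = 2 * π * k)}

/-- The set `Ŝ(p/q) = {(θ,η) : pθ+qη ∈ πℤ}`. -/
def Shat (p q : ℤ) : Set (ℝ × ℝ) :=
  {x | ∃ k : ℤ, (p : ℝ) * x.1 + (q : ℝ) * x.2 = π * k}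

/-- The open strip `W* = ℝ × (0, 2π)`. -/
def Wstar : Set (ℝ × ℝ) :=
  {x | 0 < x.2 ∧ x.2 < 2 * π}

/-- Two points `a ≠ b` are adjacent in `L` relative to the set `X` of intersection points:
they lie on the same connected component of `L` and no point of `X` lies strictly
between them. -/
def AdjacentIn (L X : Set (ℝ × ℝ)) (a b : ℝ × ℝ) : Prop :=
  a ≠ b ∧ b ∈ connectedComponentIn L a ∧ ∀ c ∈ X, c ∉ openSegment ℝ a b

/-- The quantity `d₁(r₁,r₂)` of the paper, where `r₁ = p₁/q₁` and `r₂ = p₂/q₂`: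
`2π|p₁|/Δ(r₁,r₂)` if `p₂` is even, and `π|p₁|/Δ(r₁,r₂)` if `p₂` is odd
(`d₂(r₁,r₂)` is obtained by swapping the roles of the two fractions). -/
noncomputable def dd (p₁ q₁ p₂ q₂ : ℤ) : ℝ :=
  if Even p₂ then 2 * π * |(p₁ : ℝ)| / |((p₁ * q₂ - p₂ * q₁ : ℤ) : ℝ)|
  else π * |(p₁ : ℝ)| / |((p₁ * q₂ - p₂ * q₁ : ℤ) : ℝ)|

/-- The spacing of the values of `pθ + qη` on `S(p/q)`. -/
noncomputable def spacing (p : ℤ) : ℝ := if Even p then 2 * π else π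

lemma spacing_pos (p : ℤ) : 0 < spacing p := by
  unfold spacing
  split_ifs <;> positivity

lemma mem_Spq_iff (p q : ℤ) (x : ℝ × ℝ) :
    x ∈ Spq p q ↔ ∃ k : ℤ, (p : ℝ) * x.1 + (q : ℝ) * x.2 = spacing p * k := by
  unfold Spq spacing
  simp only [Set.mem_ofPred_eq]
  rcases Int.even_or_odd' p with ⟨m, rfl | rfl⟩
  · rw [if_pos (even_two_mul m)]
    constructor
    · rintro (⟨k, hk⟩ | ⟨k, hk⟩)
      · exact ⟨k, hk⟩
      · refine ⟨k - m, ?_⟩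
        push_cast at hk ⊢
        linarith
    · exact Or.inl
  · rw [if_neg (by simp)]
    constructor
    · rintro (⟨k, hk⟩ | ⟨k, hk⟩)
      · refine ⟨2 * k, ?_⟩
        push_cast at hk ⊢
        linarith
      · refine ⟨2 * k - (2 * m + 1), ?_⟩
        push_cast at hk ⊢
        linarith
    · rintro ⟨k, hk⟩
      rcases Int.even_or_odd' k with ⟨j, rfl | rfl⟩
      · refine Or.inl ⟨j, ?_⟩
        push_cast at hk ⊢
        linarith
      · refine Or.inr ⟨j + m + 1, ?_⟩
        push_cast at hk ⊢
        linarith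

lemma dd_eq (p₁ q₁ p₂ q₂ : ℤ) :
    dd p₁ q₁ p₂ q₂ = spacing p₂ * |(p₁ : ℝ)| / |((p₁ * q₂ - p₂ * q₁ : ℤ) : ℝ)| := by
  unfold dd spacing
  split_ifs <;> rfl

lemma dd_pos {p₁ q₁ p₂ q₂ : ℤ} (hp₁ : p₁ ≠ 0) (hne : p₁ * q₂ ≠ p₂ * q₁) :
    0 < dd p₁ q₁ p₂ q₂ := by
  have hD : ((p₁ * q₂ - p₂ * q₁ : ℤ) : ℝ) ≠ 0 := Int.cast_ne_zero.2 (sub_ne_zero.2 hne)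
  have hp : (p₁ : ℝ) ≠ 0 := Int.cast_ne_zero.2 hp₁
  have := spacing_pos p₂
  rw [dd_eq]
  positivity

lemma convex_Wstar : Convex ℝ Wstar :=
  (convex_Ioo (0 : ℝ) (2 * π)).linear_preimage (LinearMap.snd ℝ ℝ ℝ)

/-- A vertical displacement `±d₁` along `S(r₁)` that stays in the strip reaches an adjacent
intersection point. -/
lemma exists_adjacentIn_of_abs_eq_dd {p₁ q₁ p₂ q₂ : ℤ} (hp₁ : p₁ ≠ 0)
    (hne : p₁ * q₂ ≠ p₂ * q₁) {a : ℝ × ℝ} (ha : a ∈ Spq p₁ q₁ ∩ Spq p₂ q₂ ∩ Wstar)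
    {e : ℝ} (he : |e| = dd p₁ q₁ p₂ q₂) (he₀ : 0 < a.2 + e) (he₁ : a.2 + e < 2 * π) :
    ∃ b ∈ Spq p₁ q₁ ∩ Spq p₂ q₂ ∩ Wstar,
      AdjacentIn (Spq p₁ q₁ ∩ Wstar) (Spq p₁ q₁ ∩ Spq p₂ q₂ ∩ Wstar) a b ∧ b.2 = a.2 + e := by
  obtain ⟨⟨h₁, h₂⟩, hW⟩ := ha
  have hD : ((p₁ * q₂ - p₂ * q₁ : ℤ) : ℝ) ≠ 0 := Int.cast_ne_zero.2 (sub_ne_zero.2 hne)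
  have hp : (p₁ : ℝ) ≠ 0 := Int.cast_ne_zero.2 hp₁
  have hc := spacing_pos p₂
  have he_ne : e ≠ 0 := abs_pos.1 (he ▸ dd_pos hp₁ hne)
  obtain ⟨t, rfl⟩ : ∃ t : ℝ, e = t * p₁ := ⟨e / p₁, by field_simp⟩
  obtain ⟨ε, hε, ht⟩ : ∃ ε : ℤ, (ε = 1 ∨ ε = -1) ∧
      t * ((p₁ : ℝ) * q₂ - p₂ * q₁) = ε * spacing p₂ := by
    have habs : |t * ((p₁ * q₂ - p₂ * q₁ : ℤ) : ℝ)| = |spacing p₂| := by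
      rw [dd_eq, eq_div_iff (abs_ne_zero.2 hD), abs_mul] at he
      rw [abs_mul, abs_of_pos hc]
      exact mul_right_cancel₀ (abs_ne_zero.2 hp) (by linarith)
    push_cast at habs
    rcases abs_eq_abs.1 habs with h | h
    · exact ⟨1, Or.inl rfl, by simpa using h⟩
    · exact ⟨-1, Or.inr rfl, by simpa using h⟩
  obtain ⟨k₁, hk₁⟩ := (mem_Spq_iff p₁ q₁ a).1 h₁
  obtain ⟨k₂, hk₂⟩ := (mem_Spq_iff p₂ q₂ a).1 h₂
  set b : ℝ × ℝ := (a.1 - t * q₁, a.2 + t * p₁) with hb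
  have hb₁ : b ∈ Spq p₁ q₁ := by
    refine (mem_Spq_iff _ _ _).2 ⟨k₁, ?_⟩
    simp only [hb]
    linarith
  have hb₂ : b ∈ Spq p₂ q₂ := by
    refine (mem_Spq_iff _ _ _).2 ⟨k₂ + ε, ?_⟩
    simp only [hb]
    push_cast
    linarith
  have hbW : b ∈ Wstar := ⟨he₀, he₁⟩
  refine ⟨b, ⟨⟨hb₁, hb₂⟩, hbW⟩, ⟨fun hab => ?_, ?_, ?_⟩, rfl⟩
  · have := congrArg Prod.snd hab
    simp only [hb] at this
    exact he_ne (by linarith)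
  · refine (convex_segment a b).isPreconnected.subset_connectedComponentIn
      (left_mem_segment ℝ a b) ?_ (right_mem_segment ℝ a b)
    intro x hx
    refine ⟨?_, convex_Wstar.segment_subset hW hbW hx⟩
    rw [segment_eq_image'] at hx
    obtain ⟨u, -, rfl⟩ := hx
    refine (mem_Spq_iff _ _ _).2 ⟨k₁, ?_⟩
    simp only [hb, Prod.fst_add, Prod.snd_add, Prod.smul_fst, Prod.smul_snd, Prod.fst_sub,
      Prod.snd_sub, smul_eq_mul]
    linarith
  · rintro x ⟨⟨-, hx₂⟩, -⟩ hx
    rw [openSegment_eq_image'] at hx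
    obtain ⟨u, ⟨hu₀, hu₁⟩, rfl⟩ := hx
    obtain ⟨k, hk⟩ := (mem_Spq_iff _ _ _).1 hx₂
    simp only [hb, Prod.fst_add, Prod.snd_add, Prod.smul_fst, Prod.smul_snd, Prod.fst_sub,
      Prod.snd_sub, smul_eq_mul] at hk
    have hku : ((k - k₂ : ℤ) : ℝ) = u * ε := by
      push_cast
      apply mul_left_cancel₀ hc.ne'
      linear_combination u * ht + hk₂ - hk
    generalize k - k₂ = n at hku
    rcases hε with rfl | rfl
    · have h0 : (0 : ℝ) < n := by simpa [hku] using hu₀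
      have h1 : (n : ℝ) < 1 := by simpa [hku] using hu₁
      norm_cast at h0 h1
      omega
    · have h0 : (n : ℝ) < 0 := by simpa [hku] using hu₀
      have h1 : (-1 : ℝ) < n := by simpa [hku] using hu₁
      norm_cast at h0 h1
      omega

/-- The two existence claims for adjacency in `S(r₁)`. -/
lemma exists_adjacentIn_below_and_above {p₁ q₁ p₂ q₂ : ℤ} (hp₁ : p₁ ≠ 0)
    (hne : p₁ * q₂ ≠ p₂ * q₁) {a : ℝ × ℝ} (ha : a ∈ Spq p₁ q₁ ∩ Spq p₂ q₂ ∩ Wstar) :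
    (dd p₁ q₁ p₂ q₂ < a.2 → ∃ b ∈ Spq p₁ q₁ ∩ Spq p₂ q₂ ∩ Wstar,
      AdjacentIn (Spq p₁ q₁ ∩ Wstar) (Spq p₁ q₁ ∩ Spq p₂ q₂ ∩ Wstar) a b ∧ b.2 < a.2) ∧
    (a.2 < 2 * π - dd p₁ q₁ p₂ q₂ → ∃ b ∈ Spq p₁ q₁ ∩ Spq p₂ q₂ ∩ Wstar,
      AdjacentIn (Spq p₁ q₁ ∩ Wstar) (Spq p₁ q₁ ∩ Spq p₂ q₂ ∩ Wstar) a b ∧ a.2 < b.2) := by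
  have hd := dd_pos hp₁ hne
  obtain ⟨h0, h1⟩ : 0 < a.2 ∧ a.2 < 2 * π := ha.2
  constructor <;> intro h
  · obtain ⟨b, hb, hadj, h2⟩ := exists_adjacentIn_of_abs_eq_dd hp₁ hne ha
      (e := -dd p₁ q₁ p₂ q₂) (by rw [abs_neg, abs_of_pos hd]) (by linarith) (by linarith)
    exact ⟨b, hb, hadj, by linarith⟩
  · obtain ⟨b, hb, hadj, h2⟩ := exists_adjacentIn_of_abs_eq_dd hp₁ hne ha
      (abs_of_pos hd) (by linarith) (by linarith)
    exact ⟨b, hb, hadj, by linarith⟩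

/-- Existence of adjacent intersection points below / above a given point of
`S(r₁) ∩ S(r₂) ∩ W*`, provided there is room (`η > dᵢ`, resp. `η < 2π - dᵢ`). -/
theorem statement_8 (p₁ q₁ p₂ q₂ : ℤ) (hq₁ : q₁ ≠ 0) (hq₂ : q₂ ≠ 0)
    (hp₁ : p₁ ≠ 0) (hp₂ : p₂ ≠ 0)
    (hc₁ : IsCoprime p₁ q₁) (hc₂ : IsCoprime p₂ q₂)
    (hne : p₁ * q₂ ≠ p₂ * q₁)
    (a : ℝ × ℝ) (ha : a ∈ Spq p₁ q₁ ∩ Spq p₂ q₂ ∩ Wstar) :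
    ((dd p₁ q₁ p₂ q₂ < a.2 → ∃ b ∈ Spq p₁ q₁ ∩ Spq p₂ q₂ ∩ Wstar,
        AdjacentIn (Spq p₁ q₁ ∩ Wstar) (Spq p₁ q₁ ∩ Spq p₂ q₂ ∩ Wstar) a b ∧ b.2 < a.2) ∧
     (a.2 < 2 * π - dd p₁ q₁ p₂ q₂ → ∃ b ∈ Spq p₁ q₁ ∩ Spq p₂ q₂ ∩ Wstar,
        AdjacentIn (Spq p₁ q₁ ∩ Wstar) (Spq p₁ q₁ ∩ Spq p₂ q₂ ∩ Wstar) a b ∧ a.2 < b.2)) ∧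
    ((dd p₂ q₂ p₁ q₁ < a.2 → ∃ b ∈ Spq p₁ q₁ ∩ Spq p₂ q₂ ∩ Wstar,
        AdjacentIn (Spq p₂ q₂ ∩ Wstar) (Spq p₁ q₁ ∩ Spq p₂ q₂ ∩ Wstar) a b ∧ b.2 < a.2) ∧
     (a.2 < 2 * π - dd p₂ q₂ p₁ q₁ → ∃ b ∈ Spq p₁ q₁ ∩ Spq p₂ q₂ ∩ Wstar,
        AdjacentIn (Spq p₂ q₂ ∩ Wstar) (Spq p₁ q₁ ∩ Spq p₂ q₂ ∩ Wstar) a b ∧ a.2 < b.2)) := by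
  refine ⟨exists_adjacentIn_below_and_above hp₁ hne ha, ?_⟩
  rw [Set.inter_comm (Spq p₁ q₁)] at ha ⊢
  exact exists_adjacentIn_below_and_above hp₂ hne.symm ha
end
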